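/- Let G be a diregular (2,k,+3)-digraph with k ≥ 4, and let u, v be any vertices of G with exactly one common out-neighbour u₂, writing N^+(u) = {u₁, u₂} and N^+(v) = {v₁, u₂} with u₁ ≠ v₁. Then v₁ ∈ O(u), u₁ ∈ O(v), and |O(u) ∩ N^+(v₁)| = |O(v) ∩ N^+(u₁)| = 1. -/

import Mathlib

/-- `p` is a directed walk from `u` to `v` in the digraph with arc relation `A`,
recorded as the list of its vertices; a walk of length `l` (i.e. with `l` arcs)
is a list of `l + 1` vertices. -/
def IsWalkFrom {V : Type*} (A : V → V → Prop) (u v : V) (p : List V) : Prop :=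
  p.Chain' A ∧ p.head? = some u ∧ p.getLast? = some v

/-- A digraph is `k`-geodetic if for every ordered pair of vertices `(u, v)`
there is at most one directed path of length at most `k` from `u` to `v`. -/
def IsKGeodetic {V : Type*} (A : V → V → Prop) (k : ℕ) : Prop :=
  ∀ (u v : V) (p q : List V), IsWalkFrom A u v p → IsWalkFrom A u v q →
    p.length ≤ k + 1 → q.length ≤ k + 1 → p = q

/-- `Nout A u = N⁺(u)`, the set of out-neighbours of `u`. -/
def Nout {V : Type*} (A : V → V → Prop) (u : V) : Set V := {v | A u v}

/-- `Nin A u = N⁻(u)`, the set of in-neighbours of `u`. -/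
def Nin {V : Type*} (A : V → V → Prop) (u : V) : Set V := {v | A v u}

/-- `NIter A l u = N^l(u)`, the set of vertices reachable from `u` by a
directed path of length exactly `l`. -/
def NIter {V : Type*} (A : V → V → Prop) (l : ℕ) (u : V) : Set V :=
  {v | ∃ p : List V, IsWalkFrom A u v p ∧ p.length = l + 1}

/-- `Ball A l u = T_l(u) = N^0(u) ∪ N^1(u) ∪ ⋯ ∪ N^l(u)`, the set of vertices
at distance at most `l` from `u`. -/
def Ball {V : Type*} (A : V → V → Prop) (l : ℕ) (u : V) : Set V :=
  {v | ∃ m ≤ l, v ∈ NIter A m u}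

/-- `Outliers A k u = O(u) = {v | d(u,v) ≥ k + 1}`, the outlier set of `u`. -/
def Outliers {V : Type*} (A : V → V → Prop) (k : ℕ) (u : V) : Set V :=
  {v | v ∉ Ball A k u}

/-- A digraph is diregular with degree `d` if every vertex has out-degree `d`
and in-degree `d`. -/
def IsDiregular {V : Type*} (A : V → V → Prop) (d : ℕ) : Prop :=
  ∀ u : V, (Nout A u).ncard = d ∧ (Nin A u).ncard = d

/-- The Moore bound `M(d,k) = 1 + d + d² + ⋯ + d^k`. -/
def moore (d k : ℕ) : ℕ := ∑ i ∈ Finset.range (k + 1), d ^ i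

/-- `A` is the arc relation of a diregular `(2,k,+3)`-digraph with `k ≥ 4`. -/
structure IsExcessThree {V : Type*} [Fintype V] (A : V → V → Prop) (k : ℕ) : Prop where
  diregular : IsDiregular A 2
  geodetic : IsKGeodetic A k
  card_eq : Fintype.card V = moore 2 k + 3
  four_le : 4 ≤ k

/-- `u₂` is the only common out-neighbour of `u` and `v`, the other out-neighbours being
`u₁` and `v₁` respectively. -/
structure IsSiblingPair {V : Type*} (A : V → V → Prop) (u v u₁ u₂ v₁ : V) : Prop where
  left : Nout A u = {u₁, u₂}
  right : Nout A v = {v₁, u₂}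
  ne : u₁ ≠ v₁

section Walks

variable {V : Type*} {A : V → V → Prop} {k : ℕ}

lemma mem_nIter_zero {u w : V} : w ∈ NIter A 0 u ↔ w = u := by
  constructor
  · rintro ⟨p, ⟨-, h1, h2⟩, hl⟩
    obtain ⟨x, rfl⟩ := List.length_eq_one_iff.1 hl
    simp_all
  · rintro rfl
    exact ⟨[w], ⟨by simp [List.Chain'], rfl, rfl⟩, rfl⟩

lemma self_mem_nIter (u : V) : u ∈ NIter A 0 u := mem_nIter_zero.2 rfl

lemma IsWalkFrom.cons {u x w : V} {p : List V} (h : A u x) (hp : IsWalkFrom A x w p) :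
    IsWalkFrom A u w (u :: p) := by
  obtain ⟨h1, h2, h3⟩ := hp
  cases p with
  | nil => simp at h2
  | cons y q =>
    simp only [List.head?_cons, Option.some.injEq] at h2
    subst h2
    refine ⟨List.isChain_cons_cons.2 ⟨h, h1⟩, rfl, ?_⟩
    rw [List.getLast?_cons_cons]
    exact h3

lemma mem_nIter_succ {l : ℕ} {u w : V} :
    w ∈ NIter A (l + 1) u ↔ ∃ x, A u x ∧ w ∈ NIter A l x := by
  constructor
  · rintro ⟨p, ⟨h0, h1, h2⟩, hl⟩
    match p, hl with
    | a :: b :: q, hl =>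
      simp only [List.head?_cons, Option.some.injEq] at h1
      subst h1
      have h0' := List.isChain_cons_cons.1 h0
      rw [List.getLast?_cons_cons] at h2
      exact ⟨b, h0'.1, b :: q, ⟨h0'.2, rfl, h2⟩, by simpa using hl⟩
  · rintro ⟨x, hx, p, hp, hl⟩
    exact ⟨u :: p, hp.cons hx, by simp [hl]⟩

lemma mem_nIter_one {u w : V} : w ∈ NIter A 1 u ↔ A u w := by
  simp [mem_nIter_succ, mem_nIter_zero]

lemma mem_nIter_add {l m : ℕ} {u w : V} :
    w ∈ NIter A (l + m) u ↔ ∃ x, x ∈ NIter A l u ∧ w ∈ NIter A m x := by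
  induction l generalizing u with
  | zero => simp [mem_nIter_zero]
  | succ l ih =>
    rw [Nat.succ_add, mem_nIter_succ]
    simp only [mem_nIter_succ, ih]
    tauto

lemma nIter_trans {l m n : ℕ} {u x w : V} (h₁ : x ∈ NIter A l u) (h₂ : w ∈ NIter A m x)
    (h : l + m = n) : w ∈ NIter A n u :=
  h ▸ mem_nIter_add.2 ⟨x, h₁, h₂⟩

lemma nIter_cons {l n : ℕ} {u x w : V} (h₁ : A u x) (h₂ : w ∈ NIter A l x)
    (h : l + 1 = n) : w ∈ NIter A n u :=
  h ▸ mem_nIter_succ.2 ⟨x, h₁, h₂⟩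

lemma nIter_snoc {l n : ℕ} {u x w : V} (h₁ : x ∈ NIter A l u) (h₂ : A x w)
    (h : l + 1 = n) : w ∈ NIter A n u :=
  nIter_trans h₁ (mem_nIter_one.2 h₂) h

namespace IsKGeodetic

lemma length_eq (hg : IsKGeodetic A k) {l m : ℕ} {u w : V} (h₁ : w ∈ NIter A l u)
    (h₂ : w ∈ NIter A m u) (hl : l ≤ k) (hm : m ≤ k) : l = m := by
  obtain ⟨p, hp, hpl⟩ := h₁
  obtain ⟨q, hq, hql⟩ := h₂
  have := hg u w p q hp hq (by omega) (by omega)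
  subst this
  omega

lemma first_eq (hg : IsKGeodetic A k) {l m : ℕ} {u x y w : V} (hx : A u x) (hy : A u y)
    (h₁ : w ∈ NIter A l x) (h₂ : w ∈ NIter A m y) (hl : l < k) (hm : m < k) : x = y := by
  obtain ⟨p, hp, hpl⟩ := h₁
  obtain ⟨q, hq, hql⟩ := h₂
  have := hg u w _ _ (hp.cons hx) (hq.cons hy) (by simp; omega) (by simp; omega)
  obtain rfl : p = q := by simpa using this
  have := hp.2.1.symm.trans hq.2.1
  simpa using this

lemma mid_eq (hg : IsKGeodetic A k) {i j j' : ℕ} {u x y w : V} (hx : x ∈ NIter A i u)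
    (hy : y ∈ NIter A i u) (h₁ : w ∈ NIter A j x) (h₂ : w ∈ NIter A j' y) (hj : i + j ≤ k)
    (hj' : i + j' ≤ k) : x = y := by
  induction i generalizing u with
  | zero => rw [mem_nIter_zero.1 hx, mem_nIter_zero.1 hy]
  | succ i ih =>
    obtain ⟨a, ha, hx⟩ := mem_nIter_succ.1 hx
    obtain ⟨b, hb, hy⟩ := mem_nIter_succ.1 hy
    obtain rfl := hg.first_eq ha hb (nIter_trans hx h₁ rfl) (nIter_trans hy h₂ rfl)
      (by omega) (by omega)
    exact ih hx hy (by omega) (by omega)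

lemma last_eq (hg : IsKGeodetic A k) {l m : ℕ} {u x y w : V} (hx : x ∈ NIter A l u)
    (hy : y ∈ NIter A m u) (h₁ : A x w) (h₂ : A y w) (hl : l < k) (hm : m < k) : x = y := by
  have := hg.length_eq (nIter_snoc hx h₁ rfl) (nIter_snoc hy h₂ rfl) hl hm
  obtain rfl : l = m := by omega
  exact hg.mid_eq hx hy (mem_nIter_one.2 h₁) (mem_nIter_one.2 h₂) hl hl

lemma not_closed (hg : IsKGeodetic A k) {l : ℕ} {u : V} (hl : 0 < l) (hk : l ≤ k) :
    u ∉ NIter A l u := fun h =>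
  absurd (hg.length_eq h (self_mem_nIter u) hk (by omega)) (by omega)

end IsKGeodetic

end Walks

lemma adj_of_nout_left {V : Type*} {A : V → V → Prop} {u x y : V} (h : Nout A u = {x, y}) :
    A u x := by
  have : x ∈ Nout A u := by simp [h]
  exact this

lemma adj_of_nout_right {V : Type*} {A : V → V → Prop} {u x y : V} (h : Nout A u = {x, y}) :
    A u y := by
  have : y ∈ Nout A u := by simp [h]
  exact this

lemma eq_or_eq_of_nout {V : Type*} {A : V → V → Prop} {u x y w : V} (h : Nout A u = {x, y})
    (hw : A u w) : w = x ∨ w = y := by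
  have : w ∈ Nout A u := hw
  simpa [h] using this

lemma mem_outliers_or_of_nout {V : Type*} {A : V → V → Prop} {u x y : V} (h : Nout A u = {x, y}) (k : ℕ)
    (t : V) :
    t ∈ Outliers A k u ∨ t = u ∨ t ∈ Ball A (k - 1) x ∨ t ∈ Ball A (k - 1) y := by
  by_cases ht : t ∈ Outliers A k u
  · exact Or.inl ht
  obtain ⟨m, hm, hw⟩ : t ∈ Ball A k u := not_not.1 ht
  cases m with
  | zero => exact Or.inr (Or.inl (mem_nIter_zero.1 hw))
  | succ m =>
    obtain ⟨z, hz, hw⟩ := mem_nIter_succ.1 hw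
    rcases eq_or_eq_of_nout h hz with rfl | rfl
    · exact Or.inr (Or.inr (Or.inl ⟨m, by omega, hw⟩))
    · exact Or.inr (Or.inr (Or.inr ⟨m, by omega, hw⟩))

namespace IsExcessThree

variable {V : Type*} [Fintype V] {A : V → V → Prop} {k : ℕ}

lemma nout_ncard (hA : IsExcessThree A k) (u : V) : (Nout A u).ncard = 2 :=
  (hA.diregular u).1

lemma ne_of_nout (hA : IsExcessThree A k) {u x y : V} (h : Nout A u = {x, y}) : x ≠ y := by
  rintro rfl
  have := hA.nout_ncard u
  simp [h] at this

lemma exists_nout (hA : IsExcessThree A k) (u : V) : ∃ x y, x ≠ y ∧ Nout A u = {x, y} :=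
  Set.ncard_eq_two.1 (hA.nout_ncard u)

lemma exists_other_nin (hA : IsExcessThree A k) (u x : V) : ∃ a, a ≠ u ∧ A a x := by
  obtain ⟨a, b, hab, he⟩ := Set.ncard_eq_two.1 (hA.diregular x).2
  have ha : a ∈ Nin A x := by simp [he]
  have hb : b ∈ Nin A x := by simp [he]
  by_cases hau : a = u
  · exact ⟨b, fun h => hab (hau.trans h.symm), hb⟩
  · exact ⟨a, hau, ha⟩

lemma nin_eq (hA : IsExcessThree A k) {u v w x : V} (huv : u ≠ v) (hu : A u x) (hv : A v x)
    (hw : A w x) : w = u ∨ w = v := by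
  have hs : ({u, v} : Set V) = Nin A x := by
    refine Set.eq_of_subset_of_ncard_le ?_ ?_
    · rintro y (rfl | rfl)
      exacts [hu, hv]
    · rw [(hA.diregular x).2, Set.ncard_pair huv]
  have : w ∈ ({u, v} : Set V) := hs ▸ hw
  simpa using this

lemma nIter_ncard (hA : IsExcessThree A k) {l : ℕ} (hl : l ≤ k) (u : V) :
    (NIter A l u).ncard = 2 ^ l := by
  induction l generalizing u with
  | zero =>
    have : NIter A 0 u = {u} := by ext; simp [mem_nIter_zero]
    simp [this]
  | succ l ih =>
    obtain ⟨x, y, hxy, h⟩ := hA.exists_nout u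
    have he : NIter A (l + 1) u = NIter A l x ∪ NIter A l y := by
      ext w
      rw [mem_nIter_succ, Set.mem_union]
      constructor
      · rintro ⟨z, hz, hw⟩
        rcases eq_or_eq_of_nout h hz with rfl | rfl
        exacts [Or.inl hw, Or.inr hw]
      · rintro (hw | hw)
        exacts [⟨x, adj_of_nout_left h, hw⟩, ⟨y, adj_of_nout_right h, hw⟩]
    rw [he, Set.ncard_union_eq, ih (by omega), ih (by omega)]
    · ring
    · rw [Set.disjoint_left]
      intro w h₁ h₂
      exact hxy (hA.geodetic.first_eq (adj_of_nout_left h) (adj_of_nout_right h) h₁ h₂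
        (by omega) (by omega))

lemma ball_ncard (hA : IsExcessThree A k) {l : ℕ} (hl : l ≤ k) (u : V) :
    (Ball A l u).ncard = moore 2 l := by
  induction l with
  | zero =>
    have : Ball A 0 u = {u} := by ext; simp [Ball, mem_nIter_zero]
    simp [this, moore]
  | succ l ih =>
    have he : Ball A (l + 1) u = Ball A l u ∪ NIter A (l + 1) u := by
      ext w
      constructor
      · rintro ⟨m, hm, hw⟩
        rcases Nat.le_succ_iff.1 hm with hm | rfl
        exacts [Or.inl ⟨m, hm, hw⟩, Or.inr hw]
      · rintro (⟨m, hm, hw⟩ | hw)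
        exacts [⟨m, by omega, hw⟩, ⟨l + 1, le_rfl, hw⟩]
    rw [he, Set.ncard_union_eq, ih (by omega), hA.nIter_ncard hl, moore, moore,
      Finset.sum_range_succ _ (l + 1)]
    rw [Set.disjoint_left]
    rintro w ⟨m, hm, h₁⟩ h₂
    have := hA.geodetic.length_eq h₁ h₂ (by omega) hl
    omega

lemma outliers_ncard (hA : IsExcessThree A k) (u : V) : (Outliers A k u).ncard = 3 := by
  have h := Set.ncard_add_ncard_compl (Ball A k u)
  rw [hA.ball_ncard le_rfl, Nat.card_eq_fintype_card, hA.card_eq] at h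
  have he : Outliers A k u = (Ball A k u)ᶜ := rfl
  rw [he]
  omega

/-- Three distinct outliers are all the outliers. -/
lemma outliers_eq (hA : IsExcessThree A k) {u x y z : V} (hx : x ∈ Outliers A k u)
    (hy : y ∈ Outliers A k u) (hz : z ∈ Outliers A k u) (hxy : x ≠ y) (hxz : x ≠ z)
    (hyz : y ≠ z) : Outliers A k u = {x, y, z} := by
  symm
  refine Set.eq_of_subset_of_ncard_le ?_ ?_
  · rintro w (rfl | rfl | rfl)
    exacts [hx, hy, hz]
  · rw [hA.outliers_ncard, Set.ncard_eq_three.2 ⟨x, y, z, hxy, hxz, hyz, rfl⟩]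

lemma exists_third_outlier (hA : IsExcessThree A k) {u x y : V} (hx : x ∈ Outliers A k u)
    (hy : y ∈ Outliers A k u) (hxy : x ≠ y) :
    ∃ z, z ∈ Outliers A k u ∧ x ≠ z ∧ y ≠ z ∧ Outliers A k u = {x, y, z} := by
  have hlt : ({x, y} : Set V).ncard < (Outliers A k u).ncard := by
    rw [hA.outliers_ncard, Set.ncard_pair hxy]
    norm_num
  obtain ⟨z, hz, hzn⟩ := Set.exists_mem_notMem_of_ncard_lt_ncard hlt
  simp only [Set.mem_insert_iff, Set.mem_singleton_iff, not_or] at hzn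
  exact ⟨z, hz, Ne.symm hzn.1, Ne.symm hzn.2,
    hA.outliers_eq hx hy hz hxy (Ne.symm hzn.1) (Ne.symm hzn.2)⟩

lemma not_mem_ball_of_mem_outliers (hA : IsExcessThree A k) {u x t : V} (h : A u x)
    (ht : t ∈ Outliers A k u) : t ∉ Ball A (k - 1) x := by
  rintro ⟨m, hm, hw⟩
  have := hA.four_le
  exact ht ⟨m + 1, by omega, nIter_cons h hw rfl⟩

lemma not_mem_ball_of_adj (hA : IsExcessThree A k) {u x : V} (h : A u x) :
    u ∉ Ball A (k - 1) x := by
  rintro ⟨m, hm, hw⟩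
  have := hA.four_le
  exact hA.geodetic.not_closed (Nat.succ_pos m) (by omega) (nIter_cons h hw rfl)

end IsExcessThree

namespace IsSiblingPair

variable {V : Type*} {A : V → V → Prop} {k : ℕ} {u v u₁ u₂ v₁ : V}

lemma symm (hs : IsSiblingPair A u v u₁ u₂ v₁) : IsSiblingPair A v u v₁ u₂ u₁ :=
  ⟨hs.right, hs.left, hs.ne.symm⟩

lemma adj_left (hs : IsSiblingPair A u v u₁ u₂ v₁) : A u u₁ := adj_of_nout_left hs.left

lemma adj_common_left (hs : IsSiblingPair A u v u₁ u₂ v₁) : A u u₂ := adj_of_nout_right hs.left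

lemma adj_right (hs : IsSiblingPair A u v u₁ u₂ v₁) : A v v₁ := adj_of_nout_left hs.right

lemma adj_common_right (hs : IsSiblingPair A u v u₁ u₂ v₁) : A v u₂ := adj_of_nout_right hs.right

variable [Fintype V]

lemma left_ne_right (hA : IsExcessThree A k) (hs : IsSiblingPair A u v u₁ u₂ v₁) : u ≠ v := by
  rintro rfl
  rcases eq_or_eq_of_nout hs.left hs.adj_right with h | h
  · exact hs.ne h.symm
  · exact hA.ne_of_nout hs.right h

lemma mem_ball_diff (hA : IsExcessThree A k) (hs : IsSiblingPair A u v u₁ u₂ v₁) {t : V}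
    (ht : t ∈ Ball A (k - 1) v₁) : t ∈ Outliers A k u ∨ t = u ∨ t ∈ Ball A (k - 1) u₁ := by
  rcases mem_outliers_or_of_nout hs.left k t with h | h | h | h
  · exact Or.inl h
  · exact Or.inr (Or.inl h)
  · exact Or.inr (Or.inr h)
  · obtain ⟨m, hm, h₁⟩ := ht
    obtain ⟨n, hn, h₂⟩ := h
    have := hA.four_le
    exact absurd (hA.geodetic.first_eq hs.adj_right hs.adj_common_right h₁ h₂ (by omega)
      (by omega)) (hA.ne_of_nout hs.right)

lemma right_mem (hA : IsExcessThree A k) (hs : IsSiblingPair A u v u₁ u₂ v₁) :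
    v ∈ Outliers A k u ∨ v ∈ Ball A (k - 1) u₁ := by
  rcases mem_outliers_or_of_nout hs.left k v with h | h | h | h
  · exact Or.inl h
  · exact absurd h.symm (left_ne_right hA hs)
  · exact Or.inr h
  · exact absurd h (hA.not_mem_ball_of_adj hs.adj_common_right)

lemma left_not_nIter (hA : IsExcessThree A k) (hs : IsSiblingPair A u v u₁ u₂ v₁) {l : ℕ}
    (hl : l + 2 ≤ k) : u ∉ NIter A l v₁ := by
  intro h
  have h' := nIter_cons hs.adj_right (nIter_snoc h hs.adj_common_left rfl) rfl
  have := hA.geodetic.length_eq h' (mem_nIter_one.2 hs.adj_common_right) (by omega) (by omega)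
  omega

lemma nIter_of_lt (hA : IsExcessThree A k) (hs : IsSiblingPair A u v u₁ u₂ v₁) {l m : ℕ}
    {w t : V} (hl : w ∈ NIter A l v₁) (hm : w ∈ NIter A m u₁) (hlm : l < m) (hmk : m < k)
    (ht : t ∈ NIter A (k - m) w) :
    t ∈ NIter A (l + (k - m)) v₁ ∧ (t ∈ Outliers A k u ∨ t = u) := by
  have h₁ := nIter_trans hl ht rfl
  have h₂ : t ∈ NIter A k u₁ := nIter_trans hm ht (by omega)
  refine ⟨h₁, ?_⟩
  rcases mem_ball_diff hA hs ⟨l + (k - m), by omega, h₁⟩ with h | h | ⟨n, hn, h⟩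
  · exact Or.inl h
  · exact Or.inr h
  · have := hA.geodetic.length_eq h h₂ (by omega) le_rfl
    omega

/-- If the out-neighbours of `v₁` are outliers of `u` and the third outlier of `u` is `v` or
`v₁`, then the second neighbourhoods of `u₁` and `v₁` coincide as soon as no vertex at distance
two from `v₁` is at a smaller distance from `u₁`. -/
lemma nIter_two_eq (hA : IsExcessThree A k) (hs : IsSiblingPair A u v u₁ u₂ v₁)
    (hO : ∀ t ∈ Outliers A k u, t = v ∨ t = v₁ ∨ A v₁ t)
    (hlow : ∀ w ∈ NIter A 2 v₁, ∀ m < 2, w ∉ NIter A m u₁) :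
    NIter A 2 u₁ = NIter A 2 v₁ := by
  have hk := hA.four_le
  have hout : ∀ j t, 2 ≤ j → j < k → t ∈ NIter A j v₁ → t ∉ Outliers A k u := by
    intro j t hj hjk ht hto
    rcases hO t hto with rfl | rfl | h
    · exact hA.not_mem_ball_of_adj hs.adj_right ⟨j, by omega, ht⟩
    · exact hA.geodetic.not_closed (by omega) hjk.le ht
    · have := hA.geodetic.length_eq ht (mem_nIter_one.2 h) hjk.le (by omega)
      omega
  symm
  refine Set.eq_of_subset_of_ncard_le ?_ ?_
  · intro w hw
    rcases mem_ball_diff hA hs ⟨2, by omega, hw⟩ with h | rfl | ⟨m, hm, h⟩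
    · exact absurd h (hout 2 w le_rfl (by omega) hw)
    · exact absurd hw (left_not_nIter hA hs (by omega))
    · rcases lt_trichotomy m 2 with hm2 | rfl | hm2
      · exact absurd h (hlow w hw m hm2)
      · exact h
      · have hsub : NIter A (k - m) w ⊆ {u} := by
          intro t ht
          obtain ⟨h₁, h₂⟩ := nIter_of_lt hA hs hw h hm2 (by omega) ht
          exact h₂.resolve_left (hout _ t (by omega) (by omega) h₁)
        have hc := Set.ncard_le_ncard hsub
        rw [hA.nIter_ncard (by omega), Set.ncard_singleton] at hc
        have := Nat.pow_le_pow_right (n := 2) (by norm_num) (show 1 ≤ k - m by omega)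
        omega
  · rw [hA.nIter_ncard (by omega), hA.nIter_ncard (by omega)]

lemma right_mem_outliers (hA : IsExcessThree A k) (hs : IsSiblingPair A u v u₁ u₂ v₁) :
    v₁ ∈ Outliers A k u := by
  have hk := hA.four_le
  rcases mem_ball_diff hA hs ⟨0, by omega, self_mem_nIter v₁⟩ with h | h | ⟨m, hm, h⟩
  · exact h
  · exact absurd (mem_nIter_zero.2 h.symm) (left_not_nIter hA hs (l := 0) (by omega))
  exfalso
  have hm0 : 0 < m := by
    rcases Nat.eq_zero_or_pos m with rfl | h0
    · exact absurd (mem_nIter_zero.1 h).symm hs.ne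
    · exact h0
  have hdesc := fun t ht => nIter_of_lt hA hs (t := t) (self_mem_nIter v₁) h hm0 (by omega) ht
  obtain rfl : m = k - 1 := by
    by_contra hne
    have hsub : NIter A (k - m) v₁ ⊆ insert u (Outliers A k u) := fun t ht =>
      (hdesc t ht).2.symm
    have hc := (Set.ncard_le_ncard hsub).trans (Set.ncard_insert_le _ _)
    rw [hA.nIter_ncard (by omega), hA.outliers_ncard] at hc
    have h3 : k - m < 3 := by
      by_contra h3
      have := Nat.pow_le_pow_right (n := 2) (by norm_num) (show 3 ≤ k - m by omega)
      omega
    have hsub : NIter A (k - m) v₁ ⊆ Outliers A k u := fun t ht => by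
      refine (hdesc t ht).2.resolve_right ?_
      rintro rfl
      exact left_not_nIter hA hs (by omega) ht
    have hc := Set.ncard_le_ncard hsub
    rw [hA.nIter_ncard (by omega), hA.outliers_ncard, show k - m = 2 by omega] at hc
    norm_num at hc
  have hvball : v ∉ Ball A (k - 1) u₁ := by
    rintro ⟨n, hn, hv⟩
    have h1 := hA.geodetic.length_eq (nIter_snoc hv hs.adj_right rfl) h (by omega) (by omega)
    exact left_not_nIter hA hs.symm (by omega) hv
  have hv : v ∈ Outliers A k u := (right_mem hA hs).resolve_right hvball
  obtain ⟨v₃, v₄, h34, hN⟩ := hA.exists_nout v₁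
  have hout : ∀ t, A v₁ t → t ∈ Outliers A k u := fun t ht => by
    refine (hdesc t ?_).2.resolve_right ?_
    · rw [show k - (k - 1) = 1 by omega]
      exact mem_nIter_one.2 ht
    · rintro rfl
      exact left_not_nIter hA hs (l := 1) (by omega) (mem_nIter_one.2 ht)
  have h3 := adj_of_nout_left hN
  have h4 := adj_of_nout_right hN
  have hne : ∀ t, A v₁ t → v ≠ t := by
    rintro t ht rfl
    exact hA.not_mem_ball_of_adj hs.adj_right ⟨1, by omega, mem_nIter_one.2 ht⟩
  have hOeq := hA.outliers_eq hv (hout _ h3) (hout _ h4) (hne _ h3) (hne _ h4) h34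
  have hN2 := nIter_two_eq hA hs (fun t ht => by
      rw [hOeq] at ht
      rcases ht with rfl | rfl | rfl
      exacts [Or.inl rfl, Or.inr (Or.inr h3), Or.inr (Or.inr h4)]) (fun w hw m hm2 hwm => by
      have hsub : NIter A (k - 2) w ⊆ Outliers A k v := fun t ht => by
        obtain ⟨h₁, h₂⟩ := nIter_of_lt hA hs.symm hwm hw hm2 (by omega) ht
        refine h₂.resolve_right ?_
        rintro rfl
        exact hvball ⟨_, by omega, h₁⟩
      have hc := Set.ncard_le_ncard hsub
      rw [hA.nIter_ncard (by omega), hA.outliers_ncard] at hc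
      have := Nat.pow_le_pow_right (n := 2) (by norm_num) (show 2 ≤ k - 2 by omega)
      omega)
  rw [show k - 1 = 2 + (k - 3) by omega] at h
  obtain ⟨w, hw, hwv⟩ := mem_nIter_add.1 h
  rw [hN2] at hw
  exact hA.geodetic.not_closed (by omega) (by omega) (nIter_trans hw hwv rfl)

/-- If `u₁` and `v₁` have the same out-neighbours, then `v` is an outlier of `u`. -/
lemma right_mem_outliers_of_nout_eq (hA : IsExcessThree A k)
    (hs : IsSiblingPair A u v u₁ u₂ v₁) (h : Nout A u₁ = Nout A v₁) : v ∈ Outliers A k u := by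
  have hk := hA.four_le
  refine (right_mem hA hs).resolve_right ?_
  rintro ⟨m, hm, hw⟩
  cases m with
  | zero => exact left_not_nIter hA hs.symm (by omega) hw
  | succ m =>
    obtain ⟨x, hx, hw⟩ := mem_nIter_succ.1 hw
    have hx' : x ∈ Nout A v₁ := h ▸ hx
    exact hA.not_mem_ball_of_adj hs.adj_right ⟨m + 1, hm, nIter_cons hx' hw rfl⟩

/-- If `u₁` and `v₁` have the same out-neighbours, then a second in-neighbour of `u₁` is an
in-neighbour of every outlier of `u` other than `v` and `v₁`. -/
lemma other_nin (hA : IsExcessThree A k) (hs : IsSiblingPair A u v u₁ u₂ v₁)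
    (h : Nout A u₁ = Nout A v₁) {a z : V} (hau : a ≠ u) (ha : A a u₁)
    (hO : Outliers A k u = {v, v₁, z}) :
    IsSiblingPair A u a u₂ u₁ z := by
  have hk := hA.four_le
  obtain ⟨c, hc⟩ : ∃ c, Nout A a = {c, u₁} := by
    obtain ⟨x, y, -, he⟩ := hA.exists_nout a
    rcases eq_or_eq_of_nout he ha with rfl | rfl
    exacts [⟨y, he.trans (Set.pair_comm _ _)⟩, ⟨x, he⟩]
  have hac := adj_of_nout_left hc
  have hav : a ≠ v := by
    rintro rfl
    rcases eq_or_eq_of_nout hs.right ha with h' | h'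
    · exact hs.ne h'
    · exact hA.ne_of_nout hs.left h'
  have hcu : u₂ ≠ c := by
    rintro rfl
    rcases hA.nin_eq (left_ne_right hA hs) hs.adj_common_left hs.adj_common_right hac with h' | h'
    · exact hau h'
    · exact hav h'
  have hp : IsSiblingPair A u a u₂ u₁ c := ⟨hs.left.trans (Set.pair_comm _ _), hc, hcu⟩
  have hcO := right_mem_outliers hA hp
  obtain ⟨x, y, -, hN⟩ := hA.exists_nout u₁
  have hx := adj_of_nout_left hN
  have hx' : A v₁ x := by
    have : x ∈ Nout A v₁ := h ▸ hx
    exact this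
  rw [hO] at hcO
  rcases hcO with rfl | rfl | rfl
  · have h' := hA.geodetic.first_eq hac ha (nIter_cons hs.adj_right (mem_nIter_one.2 hx') rfl)
      (mem_nIter_one.2 hx) (by omega) (by omega)
    exact absurd h' (hA.ne_of_nout hc)
  · have h' := hA.geodetic.first_eq hac ha (mem_nIter_one.2 hx') (mem_nIter_one.2 hx)
      (by omega) (by omega)
    exact absurd h' (hA.ne_of_nout hc)
  · exact hp

lemma nout_ne (hA : IsExcessThree A k) (hs : IsSiblingPair A u v u₁ u₂ v₁) :
    Nout A u₁ ≠ Nout A v₁ := by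
  intro h
  have hk := hA.four_le
  have hv := right_mem_outliers_of_nout_eq hA hs h
  have hu := right_mem_outliers_of_nout_eq hA hs.symm h.symm
  have hv₁ := right_mem_outliers hA hs
  have hu₁ := right_mem_outliers hA hs.symm
  have hvv₁ : v ≠ v₁ := fun e =>
    hA.not_mem_ball_of_adj hs.adj_right ⟨0, by omega, mem_nIter_zero.2 e⟩
  have huu₁ : u ≠ u₁ := fun e =>
    hA.not_mem_ball_of_adj hs.adj_left ⟨0, by omega, mem_nIter_zero.2 e⟩
  obtain ⟨z, hz, hvz, hv₁z, hO⟩ := hA.exists_third_outlier hv hv₁ hvv₁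
  have huz : u ≠ z := by
    rintro rfl
    exact hz ⟨0, by omega, self_mem_nIter _⟩
  have hu₁z : u₁ ≠ z := by
    rintro rfl
    exact hz ⟨1, by omega, mem_nIter_one.2 hs.adj_left⟩
  have hzv : z ∈ Outliers A k v := by
    rcases mem_outliers_or_of_nout hs.right k z with h' | h' | ⟨m, hm, h'⟩ | h'
    · exact h'
    · exact absurd h'.symm hvz
    · cases m with
      | zero => exact absurd (mem_nIter_zero.1 h').symm hv₁z
      | succ m =>
        obtain ⟨x, hx, h'⟩ := mem_nIter_succ.1 h'
        have hx' : x ∈ Nout A u₁ := h ▸ hx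
        exact absurd ⟨m + 1, hm, nIter_cons hx' h' rfl⟩
          (hA.not_mem_ball_of_mem_outliers hs.adj_left hz)
    · exact absurd h' (hA.not_mem_ball_of_mem_outliers hs.adj_common_left hz)
  have hO' := hA.outliers_eq hu hu₁ hzv huu₁ huz hu₁z
  obtain ⟨a, hau, ha⟩ := hA.exists_other_nin u u₁
  obtain ⟨b, hbv, hb⟩ := hA.exists_other_nin v v₁
  have hpa := other_nin hA hs h hau ha hO
  have hpb := other_nin hA hs.symm h.symm hbv hb hO'
  have hab : IsSiblingPair A a b u₁ z v₁ :=
    ⟨hpa.right.trans (Set.pair_comm _ _), hpb.right.trans (Set.pair_comm _ _), hs.ne⟩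
  have hOa₁ := right_mem_outliers hA hab
  have hOa₂ := right_mem_outliers_of_nout_eq hA hab h
  have hOa₃ := right_mem_outliers hA hpa.symm
  have hu₂v₁ : v₁ ≠ u₂ := hA.ne_of_nout hs.right
  have hbv₁ : v₁ ≠ b := fun e =>
    hA.not_mem_ball_of_adj hb ⟨0, by omega, mem_nIter_zero.2 e.symm⟩
  have hbu₂ : b ≠ u₂ := by
    rintro rfl
    exact hbv₁ (hA.geodetic.first_eq hs.adj_right hs.adj_common_right
      (self_mem_nIter v₁) (mem_nIter_one.2 hb) (by omega) (by omega))
  have hOa := hA.outliers_eq hOa₁ hOa₂ hOa₃ hbv₁ hu₂v₁ hbu₂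
  have huz' : u ∈ Ball A (k - 1) z := by
    rcases mem_outliers_or_of_nout hab.left k u with h' | h' | h' | h'
    · rw [hOa] at h'
      rcases h' with e | e | e
      · exact absurd (mem_nIter_zero.2 e) (left_not_nIter hA hs (l := 0) (by omega))
      · subst e
        rcases eq_or_eq_of_nout hs.left hb with e | e
        · exact absurd e.symm hs.ne
        · exact absurd e hu₂v₁
      · exact absurd (mem_nIter_zero.2 e)
          (fun h' => hA.not_mem_ball_of_adj hs.adj_common_left ⟨0, by omega, h'⟩)
    · exact absurd h'.symm hau
    · exact absurd h' (hA.not_mem_ball_of_adj hs.adj_left)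
    · exact h'
  have hvz' : v ∈ Ball A (k - 1) z := by
    rcases mem_outliers_or_of_nout hab.left k v with h' | h' | h' | h'
    · rw [hOa] at h'
      rcases h' with e | e | e
      · exact absurd e hvv₁
      · exact absurd e.symm hbv
      · exact absurd (mem_nIter_zero.2 e)
          (fun h' => hA.not_mem_ball_of_adj hs.adj_common_right ⟨0, by omega, h'⟩)
    · subst h'
      rcases eq_or_eq_of_nout hs.right ha with e | e
      · exact absurd e hs.ne
      · exact absurd e (hA.ne_of_nout hs.left)
    · exact absurd h' (hA.not_mem_ball_of_mem_outliers hs.adj_left hv)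
    · exact h'
  obtain ⟨m, hm, hm'⟩ := huz'
  obtain ⟨n, hn, hn'⟩ := hvz'
  exact left_ne_right hA hs (hA.geodetic.last_eq hm' hn' hs.adj_common_left hs.adj_common_right
    (by omega) (by omega))

lemma exists_nout_not_mem_outliers (hA : IsExcessThree A k)
    (hs : IsSiblingPair A u v u₁ u₂ v₁) : ∃ t, A v₁ t ∧ t ∉ Outliers A k u := by
  have hk := hA.four_le
  by_contra! hall
  have hv₁ := right_mem_outliers hA hs
  have hu₁ := right_mem_outliers hA hs.symm
  obtain ⟨v₃, v₄, h34, hN⟩ := hA.exists_nout v₁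
  have h3 := adj_of_nout_left hN
  have h4 := adj_of_nout_right hN
  have hne : ∀ t, A v₁ t → v₁ ≠ t := by
    rintro t ht rfl
    exact hA.not_mem_ball_of_adj ht ⟨0, by omega, self_mem_nIter _⟩
  have hOeq := hA.outliers_eq hv₁ (hall _ h3) (hall _ h4) (hne _ h3) (hne _ h4) h34
  have hO : ∀ t ∈ Outliers A k u, t = v₁ ∨ A v₁ t := by
    intro t ht
    rw [hOeq] at ht
    rcases ht with rfl | rfl | rfl
    exacts [Or.inl rfl, Or.inr h3, Or.inr h4]
  have hN2 := nIter_two_eq hA hs (fun t ht => Or.inr (hO t ht)) (fun w hw m hm2 hwm => by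
    have hm1 : m = 1 := by
      by_contra hm1
      obtain rfl : m = 0 := by omega
      obtain rfl := mem_nIter_zero.1 hwm
      exact hA.not_mem_ball_of_mem_outliers hs.adj_right hu₁ ⟨2, by omega, hw⟩
    subst hm1
    have hsub : NIter A (k - 2) w ⊆ insert v (Outliers A k v \ {u₁}) := fun t ht => by
      obtain ⟨h₁, h₂⟩ := nIter_of_lt hA hs.symm hwm hw hm2 (by omega) ht
      rcases h₂ with h₂ | h₂
      · refine Or.inr ⟨h₂, ?_⟩
        rintro rfl
        exact hA.geodetic.not_closed (by omega) (by omega) h₁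
      · exact Or.inl h₂
    have hc := (Set.ncard_le_ncard hsub).trans (Set.ncard_insert_le _ _)
    rw [hA.nIter_ncard (by omega), Set.ncard_sdiff_singleton_of_mem hu₁, hA.outliers_ncard] at hc
    have := Nat.pow_le_pow_right (n := 2) (by norm_num) (show 2 ≤ k - 2 by omega)
    omega)
  rcases right_mem hA hs with h | ⟨m, hm, h⟩
  · rcases hO v h with h' | h'
    · exact hA.not_mem_ball_of_adj hs.adj_right ⟨0, by omega, mem_nIter_zero.2 h'⟩
    · exact hA.not_mem_ball_of_adj hs.adj_right ⟨1, by omega, mem_nIter_one.2 h'⟩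
  · by_cases hm2 : m < 2
    · exact left_not_nIter hA hs.symm (by omega) h
    · obtain ⟨n, rfl⟩ := Nat.exists_eq_add_of_le (not_lt.1 hm2)
      obtain ⟨w, hw, hwv⟩ := mem_nIter_add.1 h
      rw [hN2] at hw
      exact hA.not_mem_ball_of_adj hs.adj_right ⟨2 + n, hm, nIter_trans hw hwv rfl⟩

/-- An out-neighbour of `v₁` that is neither an outlier of `u` nor an out-neighbour of `u₁` has
an iterated neighbourhood contained in `O(u) ∪ {u}`. -/
lemma exists_nIter_subset (hA : IsExcessThree A k) (hs : IsSiblingPair A u v u₁ u₂ v₁) {t : V}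
    (ht : A v₁ t) (htO : t ∉ Outliers A k u) (htu : ¬ A u₁ t) :
    ∃ j, 1 ≤ j ∧ j + 1 < k ∧ NIter A j t ⊆ insert u (Outliers A k u \ {v₁}) := by
  have hk := hA.four_le
  have ht1 := mem_nIter_one.2 ht
  rcases mem_ball_diff hA hs ⟨1, by omega, ht1⟩ with h | rfl | ⟨m, hm, h⟩
  · exact absurd h htO
  · exact absurd ht1 (left_not_nIter hA hs (by omega))
  have hm1 : 1 < m := by
    by_contra hm1
    obtain rfl | rfl : m = 0 ∨ m = 1 := by omega
    · obtain rfl := mem_nIter_zero.1 h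
      exact hA.not_mem_ball_of_mem_outliers hs.adj_right (right_mem_outliers hA hs.symm)
        ⟨1, by omega, ht1⟩
    · exact htu (mem_nIter_one.1 h)
  refine ⟨k - m, by omega, by omega, fun x hx => ?_⟩
  obtain ⟨h₁, h₂⟩ := nIter_of_lt hA hs ht1 h hm1 (by omega) hx
  rcases h₂ with h₂ | h₂
  · refine Or.inr ⟨h₂, ?_⟩
    rintro rfl
    exact hA.geodetic.not_closed (by omega) (by omega) h₁
  · exact Or.inl h₂

lemma exists_nout_mem_outliers (hA : IsExcessThree A k)
    (hs : IsSiblingPair A u v u₁ u₂ v₁) : ∃ t, A v₁ t ∧ t ∈ Outliers A k u := by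
  have hk := hA.four_le
  by_contra! hall
  have hmix : ∀ x y, Nout A v₁ = {x, y} → A u₁ y → A u₁ x := by
    intro x y hN hy
    by_contra hx
    obtain ⟨c, hc⟩ : ∃ c, Nout A u₁ = {c, y} := by
      obtain ⟨p, q, -, he⟩ := hA.exists_nout u₁
      rcases eq_or_eq_of_nout he hy with rfl | rfl
      exacts [⟨q, he.trans (Set.pair_comm _ _)⟩, ⟨p, he⟩]
    have hp : IsSiblingPair A u₁ v₁ c y x := ⟨hc, hN, by
      rintro rfl
      exact hx (adj_of_nout_left hc)⟩
    have hxO := right_mem_outliers hA hp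
    have hvx := adj_of_nout_left hN
    rcases mem_ball_diff hA hs ⟨1, by omega, mem_nIter_one.2 hvx⟩ with h | rfl | ⟨m, hm, h⟩
    · exact hall x hvx h
    · exact left_not_nIter hA hs (l := 1) (by omega) (mem_nIter_one.2 hvx)
    · exact hxO ⟨m, by omega, h⟩
  obtain ⟨v₃, v₄, h34, hN⟩ := hA.exists_nout v₁
  have h3 := adj_of_nout_left hN
  have h4 := adj_of_nout_right hN
  by_cases hu4 : A u₁ v₄
  · have hu3 := hmix _ _ hN hu4
    apply nout_ne hA hs
    symm
    refine Set.eq_of_subset_of_ncard_le ?_ ?_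
    · rw [hN]
      rintro t (rfl | rfl)
      exacts [hu3, hu4]
    · rw [hA.nout_ncard, hA.nout_ncard]
  · have hu3 : ¬ A u₁ v₃ := fun h => hu4 (hmix _ _ (hN.trans (Set.pair_comm _ _)) h)
    obtain ⟨i, hi, hik, hsi⟩ := exists_nIter_subset hA hs h3 (hall _ h3) hu3
    obtain ⟨j, hj, hjk, hsj⟩ := exists_nIter_subset hA hs h4 (hall _ h4) hu4
    have hd : Disjoint (NIter A i v₃) (NIter A j v₄) := by
      rw [Set.disjoint_left]
      intro w h₁ h₂
      exact h34 (hA.geodetic.first_eq h3 h4 h₁ h₂ (by omega) (by omega))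
    have hc := (Set.ncard_le_ncard (Set.union_subset hsi hsj)).trans (Set.ncard_insert_le _ _)
    rw [Set.ncard_union_eq hd, hA.nIter_ncard (by omega), hA.nIter_ncard (by omega),
      Set.ncard_sdiff_singleton_of_mem (right_mem_outliers hA hs), hA.outliers_ncard] at hc
    have hi' := Nat.pow_le_pow_right (n := 2) (by norm_num) hi
    have hj' := Nat.pow_le_pow_right (n := 2) (by norm_num) hj
    omega

lemma ncard_outliers_inter_nout (hA : IsExcessThree A k)
    (hs : IsSiblingPair A u v u₁ u₂ v₁) : (Outliers A k u ∩ Nout A v₁).ncard = 1 := by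
  obtain ⟨x, hx, hxO⟩ := exists_nout_mem_outliers hA hs
  obtain ⟨y, hy, hyO⟩ := exists_nout_not_mem_outliers hA hs
  have h₁ : 0 < (Outliers A k u ∩ Nout A v₁).ncard :=
    (Set.ncard_pos (Set.toFinite _)).2 ⟨x, hxO, hx⟩
  have h₂ : (Outliers A k u ∩ Nout A v₁).ncard < (Nout A v₁).ncard :=
    Set.ncard_lt_ncard ⟨Set.inter_subset_right, fun h => hyO (h hy).1⟩
  rw [hA.nout_ncard] at h₂
  omega

end IsSiblingPair

/-- For `k ≥ 4`, in a diregular `(2,k,+3)`-digraph, for any vertices `u, v`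
with exactly one common out-neighbour `u₂` (writing `N⁺(u) = {u₁,u₂}`,
`N⁺(v) = {v₁,u₂}`, `u₁ ≠ v₁`): `v₁ ∈ O(u)`, `u₁ ∈ O(v)`, and
`|O(u) ∩ N⁺(v₁)| = |O(v) ∩ N⁺(u₁)| = 1`. -/
theorem main_corollary {V : Type*} [Fintype V] (A : V → V → Prop) (k : ℕ)
    (u v u₁ u₂ v₁ : V)
    (hirr : Irreflexive A) (hreg : IsDiregular A 2) (hgeo : IsKGeodetic A k)
    (hcard : Fintype.card V = moore 2 k + 3)
    (hu : Nout A u = {u₁, u₂}) (hv : Nout A v = {v₁, u₂}) (huv : u₁ ≠ v₁)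
    (hk : 4 ≤ k) :
    v₁ ∈ Outliers A k u ∧ u₁ ∈ Outliers A k v ∧
      (Outliers A k u ∩ Nout A v₁).ncard = 1 ∧
      (Outliers A k v ∩ Nout A u₁).ncard = 1 := by
  have hA : IsExcessThree A k := ⟨hreg, hgeo, hcard, hk⟩
  have hs : IsSiblingPair A u v u₁ u₂ v₁ := ⟨hu, hv, huv⟩
  exact ⟨hs.right_mem_outliers hA, hs.symm.right_mem_outliers hA,
    hs.ncard_outliers_inter_nout hA, hs.symm.ncard_outliers_inter_nout hA⟩
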